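/- arXiv:1703.02462 — 2 statements merged into one kernel-verified Lean document; each statement's English description precedes it below -/
import Mathlib

section
/- Let η̃ > 0, g̃ ∈ ℝ, λ ≥ 0 and γ > 1/η̃ with γ > 1. Then the function f(β) = (1/2) η̃ β² − g̃ β + p_λ(|β|), where p_λ is the MC+ penalty with parameters λ and γ, attains a global minimum on ℝ at β* given by: β* = S(g̃, λ) / (η̃ − 1/γ) if |g̃| ≤ η̃λγ, and β* = g̃/η̃ if |g̃| ≥ η̃λγ. -/
/-- The soft-thresholding operator `S(z, λ) = sign(z)(|z| − λ)₊`. -/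
noncomputable def softThresh (z lam : ℝ) : ℝ :=
  Real.sign z * max (|z| - lam) 0

/-- The MC+ penalty with parameters `λ` and `γ`: `p_λ(θ) = λθ − θ²/(2γ)` for `θ ≤ γλ`
and `p_λ(θ) = γλ²/2` for `θ ≥ γλ`. -/
noncomputable def mcp (lam γ θ : ℝ) : ℝ :=
  if θ ≤ γ * lam then lam * θ - θ ^ 2 / (2 * γ) else γ * lam ^ 2 / 2

theorem mcp_of_le {lam γ θ : ℝ} (h : θ ≤ γ * lam) :
    mcp lam γ θ = lam * θ - θ ^ 2 / (2 * γ) :=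
  if_pos h

theorem mcp_of_ge {lam γ θ : ℝ} (hγ : 0 < γ) (h : γ * lam ≤ θ) :
    mcp lam γ θ = γ * lam ^ 2 / 2 := by
  rcases h.eq_or_lt with rfl | h
  · rw [mcp_of_le le_rfl]
    field_simp
    ring
  · exact if_neg h.not_ge

theorem quadratic_le_mcp {γ : ℝ} (lam θ : ℝ) (hγ : 0 < γ) :
    lam * θ - θ ^ 2 / (2 * γ) ≤ mcp lam γ θ := by
  rcases le_total θ (γ * lam) with h | h
  · exact (mcp_of_le h).ge
  · rw [mcp_of_ge hγ h]
    have key : γ * lam ^ 2 / 2 - (lam * θ - θ ^ 2 / (2 * γ)) = (θ - γ * lam) ^ 2 / (2 * γ) := by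
      field_simp
      ring
    have : 0 ≤ (θ - γ * lam) ^ 2 / (2 * γ) := by positivity
    linarith

theorem abs_softThresh {z lam : ℝ} (hlam : 0 ≤ lam) :
    |softThresh z lam| = max (|z| - lam) 0 := by
  have hm : 0 ≤ max (|z| - lam) 0 := le_max_right _ _
  rcases lt_trichotomy z 0 with hz | rfl | hz
  · simp [softThresh, Real.sign_of_neg hz, abs_of_nonneg hm]
  · simp [softThresh, hlam]
  · simp [softThresh, Real.sign_of_pos hz, abs_of_nonneg hm]

theorem mul_softThresh (z lam : ℝ) :
    z * softThresh z lam = |z| * max (|z| - lam) 0 := by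
  rcases lt_trichotomy z 0 with hz | rfl | hz
  · simp [softThresh, Real.sign_of_neg hz, abs_of_neg hz]
  · simp
  · simp [softThresh, Real.sign_of_pos hz, abs_of_pos hz]

/-- The nonnegative minimizer of `a t² / 2 - b t` over `t ≥ 0` is `max b 0 / a`. -/
theorem quadratic_min_on_nonneg {a b t : ℝ} (ha : 0 < a) (ht : 0 ≤ t) :
    a * (max b 0 / a) ^ 2 / 2 - b * (max b 0 / a) ≤ a * t ^ 2 / 2 - b * t := by
  set s := max b 0 / a with hs
  have has : a * s = max b 0 := by rw [hs]; field_simp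
  have hbs : b * s = a * s ^ 2 := by
    rcases le_total b 0 with h | h
    · simp [hs, max_eq_right h]
    · rw [max_eq_left h] at has
      rw [← has]
      ring
  have hbt : b * t ≤ a * s * t := by
    rw [has]
    exact mul_le_mul_of_nonneg_right (le_max_left _ _) ht
  nlinarith [mul_nonneg ha.le (sq_nonneg (t - s))]

/-- Let `η̃ > 0`, `g̃ ∈ ℝ`, `λ ≥ 0` and `γ > 1/η̃` with `γ > 1`.  Then
`f(β) = (1/2) η̃ β² − g̃ β + p_λ(|β|)` (MC+ penalty) attains a global minimum on `ℝ` at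
`β* = S(g̃, λ) / (η̃ − 1/γ)` if `|g̃| ≤ η̃λγ`, and `β* = g̃/η̃` if `|g̃| ≥ η̃λγ`. -/
theorem mcp_coordinate_update (η g lam γ : ℝ) (hη : 0 < η) (hlam : 0 ≤ lam)
    (hγη : γ > 1 / η) (hγ : γ > 1) :
    ((|g| ≤ η * lam * γ →
        ∀ β : ℝ,
          (1 / 2) * η * (softThresh g lam / (η - 1 / γ)) ^ 2
              - g * (softThresh g lam / (η - 1 / γ))
              + mcp lam γ |softThresh g lam / (η - 1 / γ)|
          ≤ (1 / 2) * η * β ^ 2 - g * β + mcp lam γ |β|)) ∧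
    ((η * lam * γ ≤ |g| →
        ∀ β : ℝ, (1 / 2) * η * (g / η) ^ 2 - g * (g / η) + mcp lam γ |g / η|
          ≤ (1 / 2) * η * β ^ 2 - g * β + mcp lam γ |β|)) := by
  have hγ0 : 0 < γ := by linarith
  have hηγ : 1 < η * γ := by
    have := (div_lt_iff₀ hη).1 hγη
    linarith
  have ha : 0 < η - 1 / γ := by
    have : 1 / γ < η := (div_lt_iff₀ hγ0).2 hηγ
    linarith
  have hgβ (β : ℝ) : g * β ≤ |g| * |β| := by
    rw [← abs_mul]
    exact le_abs_self _
  refine ⟨fun hg β => ?_, fun hg β => ?_⟩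
  · set b := softThresh g lam / (η - 1 / γ) with hb
    have habs : |b| = max (|g| - lam) 0 / (η - 1 / γ) := by
      rw [hb, abs_div, abs_softThresh hlam, abs_of_pos ha]
    have hgb : g * b = |g| * |b| := by
      rw [habs, hb, ← mul_div_assoc, mul_softThresh, mul_div_assoc]
    have hle : |b| ≤ γ * lam := by
      have hc : γ * lam * (η - 1 / γ) = η * lam * γ - lam := by
        field_simp
      rw [habs, div_le_iff₀ ha, hc]
      refine max_le (by linarith) ?_
      rw [← hc]
      positivity
    have hmin := quadratic_min_on_nonneg (b := |g| - lam) ha (abs_nonneg β)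
    rw [← habs] at hmin
    have hβ := quadratic_le_mcp lam |β| hγ0
    rw [mcp_of_le hle, hgb, ← sq_abs b, ← sq_abs β]
    have expand (t : ℝ) : (η - 1 / γ) * t ^ 2 / 2 - (|g| - lam) * t
        = 1 / 2 * η * t ^ 2 - |g| * t + (lam * t - t ^ 2 / (2 * γ)) := by
      field_simp
      ring
    rw [expand, expand] at hmin
    linarith [hgβ β]
  · have habs : |g / η| = |g| / η := by rw [abs_div, abs_of_pos hη]
    have hge : γ * lam ≤ |g| / η := by
      rw [le_div_iff₀ hη]
      linarith
    rw [habs, mcp_of_ge hγ0 hge, ← sq_abs β]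
    set s := |g| / η with hs
    have hgs : |g| = η * s := by rw [hs]; field_simp
    have hval : 1 / 2 * η * (g / η) ^ 2 - g * (g / η) = -(η * s ^ 2 / 2) := by
      rw [hs, div_pow |g|, sq_abs]
      field_simp
      ring
    have hlin := hgβ β
    rw [hgs] at hlin
    rw [hval]
    rcases le_total |β| (γ * lam) with h | h
    · rw [mcp_of_le h]
      have hgap : lam * |β| - |β| ^ 2 / (2 * γ)
          = γ * lam ^ 2 / 2 - 1 / γ * (γ * lam - |β|) ^ 2 / 2 := by
        field_simp
        ring
      have hsq : 1 / γ * (γ * lam - |β|) ^ 2 ≤ η * (s - |β|) ^ 2 := by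
        have : 0 ≤ γ * lam - |β| := by linarith
        gcongr
        linarith
      rw [hgap]
      linarith
    · rw [mcp_of_ge hγ0 h]
      linarith [mul_nonneg hη.le (sq_nonneg (s - |β|))]
end

section
/- For every λ ≥ 0, γ > 2 and θ̃ ∈ ℝ, the univariate SCAD-penalized least-squares function Q(θ) = (1/2)(θ − θ̃)² + p_λ(|θ|), where p_λ is the SCAD penalty with parameters λ and γ, is a convex function on ℝ. -/
/-- The SCAD penalty with parameters `λ` and `γ`. -/
noncomputable def scad (lam γ θ : ℝ) : ℝ :=
  if θ ≤ lam then lam * θ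
  else if θ ≤ γ * lam then (γ * lam * θ - (θ ^ 2 + lam ^ 2) / 2) / (γ - 1)
  else lam ^ 2 * (γ ^ 2 - 1) / (2 * (γ - 1))

/-- The SCAD penalty is a combination of `θ` and two squared positive parts. -/
lemma scad_eq_posPart {lam γ : ℝ} (hlam : 0 ≤ lam) (hγ : 2 < γ) (θ : ℝ) :
    scad lam γ θ = lam * θ - (γ - 1)⁻¹ / 2 * (max (θ - lam) 0) ^ 2
      + (γ - 1)⁻¹ / 2 * (max (θ - γ * lam) 0) ^ 2 := by
  have hγ' : γ - 1 ≠ 0 := by linarith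
  have hle : lam ≤ γ * lam := by nlinarith
  unfold scad
  split_ifs with h₁ h₂
  · rw [max_eq_right (by linarith), max_eq_right (by linarith)]
    ring
  · rw [max_eq_left (by linarith), max_eq_right (by linarith)]
    field_simp
    ring
  · rw [max_eq_left (by linarith), max_eq_left (by linarith)]
    field_simp
    ring

lemma convexOn_sq_max_abs_sub (a : ℝ) :
    ConvexOn ℝ Set.univ (fun θ : ℝ => (max (|θ| - a) 0) ^ 2) := by
  have habs : ConvexOn ℝ Set.univ (fun θ : ℝ => |θ|) := convexOn_norm convex_univ
  have hmax : ConvexOn ℝ Set.univ (fun θ : ℝ => max (|θ| - a) 0) :=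
    (habs.sub (concaveOn_const a convex_univ)).sup (convexOn_const 0 convex_univ)
  exact hmax.pow (fun _ _ => le_max_right _ _) 2

/-- Each `u ∈ [-a, a]` gives an affine minorant of `θ ^ 2 - (|θ| - a)₊ ^ 2`. -/
lemma two_mul_mul_sub_sq_le {a u : ℝ} (hu : |u| ≤ a) (x : ℝ) :
    2 * x * u - u ^ 2 ≤ x ^ 2 - (max (|x| - a) 0) ^ 2 := by
  have h : max (|x| - a) 0 ≤ |x - u| :=
    max_le (by linarith [abs_sub_abs_le_abs_sub x u]) (abs_nonneg _)
  have h' := pow_le_pow_left₀ (le_max_right _ _) h 2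
  rw [sq_abs] at h'
  linarith

lemma exists_eq_two_mul_mul_sub_sq {a : ℝ} (ha : 0 ≤ a) (x : ℝ) :
    ∃ u, |u| ≤ a ∧ x ^ 2 - (max (|x| - a) 0) ^ 2 = 2 * x * u - u ^ 2 := by
  rcases le_total |x| a with h | h
  · refine ⟨x, h, ?_⟩
    rw [max_eq_right (by linarith)]
    ring
  rw [max_eq_left (by linarith)]
  rcases abs_cases x with ⟨hx, -⟩ | ⟨hx, -⟩ <;> rw [hx]
  · exact ⟨a, (abs_of_nonneg ha).le, by ring⟩
  · exact ⟨-a, by rw [abs_neg, abs_of_nonneg ha], by ring⟩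

/-- The Huber function is convex, being a maximum of affine functions. -/
lemma convexOn_sq_sub_sq_max_abs_sub {a : ℝ} (ha : 0 ≤ a) :
    ConvexOn ℝ Set.univ (fun θ : ℝ => θ ^ 2 - (max (|θ| - a) 0) ^ 2) := by
  refine ⟨convex_univ, fun x _ y _ s t hs ht hst => ?_⟩
  obtain ⟨u, hu, h⟩ := exists_eq_two_mul_mul_sub_sq ha (s • x + t • y)
  have hx := mul_le_mul_of_nonneg_left (two_mul_mul_sub_sq_le hu x) hs
  have hy := mul_le_mul_of_nonneg_left (two_mul_mul_sub_sq_le hu y) ht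
  simp only [smul_eq_mul] at h ⊢
  rw [h]
  linear_combination hx + hy + u ^ 2 * hst

/-- For every `λ ≥ 0`, `γ > 2` and `θ̃ ∈ ℝ`, the univariate
SCAD-penalized least-squares function `Q(θ) = (1/2)(θ − θ̃)² + p_λ(|θ|)` is convex on `ℝ`. -/
theorem scad_penalized_ls_convex (lam γ θt : ℝ) (hlam : 0 ≤ lam) (hγ : 2 < γ) :
    ConvexOn ℝ Set.univ (fun θ : ℝ => (1 / 2) * (θ - θt) ^ 2 + scad lam γ |θ|) := by
  have hc : 0 ≤ (γ - 1)⁻¹ / 2 := div_nonneg (inv_nonneg.2 (by linarith)) zero_le_two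
  have hc' : 0 ≤ 1 / 2 - (γ - 1)⁻¹ / 2 := by
    linarith [inv_le_one_of_one_le₀ (show 1 ≤ γ - 1 by linarith)]
  have habs : ConvexOn ℝ Set.univ (fun θ : ℝ => |θ|) := convexOn_norm convex_univ
  have hsq : ConvexOn ℝ Set.univ (fun θ : ℝ => θ ^ 2) := even_two.convexOn_pow
  have hlin : ConvexOn ℝ Set.univ (fun θ : ℝ => -θt * θ) :=
    (LinearMap.mulLeft ℝ (-θt)).convexOn convex_univ
  refine ((((((hsq.smul hc').add ((convexOn_sq_sub_sq_max_abs_sub hlam).smul hc)).add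
    (habs.smul hlam)).add ((convexOn_sq_max_abs_sub (γ * lam)).smul hc)).add hlin).add_const
    (θt ^ 2 / 2)).congr fun θ _ => ?_
  simp only [Pi.add_apply, smul_eq_mul, scad_eq_posPart hlam hγ]
  ring
end
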